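/- Let n ≥ 4 be an integer and p a prime. The number of matrices C₀ ∈ R₀^(n)(p) such that C₀·D^(n)(p) belongs to the double coset Λ_n diag(p, p, p², …, p², p³, p³) Λ_n (with n−4 entries equal to p²) equals p²·((n−3)·p^{n−2} − (n−2)·p^{n−3} + 1)/(p−1). -/

import Mathlib

open Matrix

/-- `Λ_n = GL_n(ℤ)` viewed inside the `n × n` rational matrices: the matrices with integer
entries whose determinant is `±1`. -/
def Lambda (n : ℕ) : Set (Matrix (Fin n) (Fin n) ℚ) :=
  {γ | (∀ i j, ∃ z : ℤ, γ i j = (z : ℚ)) ∧ (γ.det = 1 ∨ γ.det = -1)}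

/-- The right coset `Λ_n h = {γ * h : γ ∈ Λ_n}`. -/
def rightCoset (n : ℕ) (h : Matrix (Fin n) (Fin n) ℚ) : Set (Matrix (Fin n) (Fin n) ℚ) :=
  {m | ∃ γ ∈ Lambda n, m = γ * h}

/-- The double coset `Λ_n g Λ_n = {γ₁ * g * γ₂ : γ₁, γ₂ ∈ Λ_n}`. -/
def doubleCoset (n : ℕ) (g : Matrix (Fin n) (Fin n) ℚ) : Set (Matrix (Fin n) (Fin n) ℚ) :=
  {m | ∃ γ₁ ∈ Lambda n, ∃ γ₂ ∈ Lambda n, m = γ₁ * g * γ₂}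

/-- The degree of `g`: the number of distinct right cosets `Λ_n h` contained in `Λ_n g Λ_n`. -/
noncomputable def degree (n : ℕ) (g : Matrix (Fin n) (Fin n) ℚ) : ℕ :=
  Set.ncard {S : Set (Matrix (Fin n) (Fin n) ℚ) | ∃ h ∈ doubleCoset n g, S = rightCoset n h}

/-- The `k`-th determinantal divisor of an `n × n` integer matrix: the gcd of all of its
`k × k` minors (which is `0` when all these minors vanish), a minor being indexed by a pair
of strictly increasing maps `Fin k → Fin n` selecting rows and columns. -/
def detDiv (n k : ℕ) (C : Matrix (Fin n) (Fin n) ℤ) : ℤ :=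
  Finset.gcd ((Finset.univ : Finset ((Fin k → Fin n) × (Fin k → Fin n))).filter
      (fun fg => (∀ a b : Fin k, a < b → fg.1 a < fg.1 b) ∧
        (∀ a b : Fin k, a < b → fg.2 a < fg.2 b)))
    (fun fg => (C.submatrix fg.1 fg.2).det)

/-- `D^(n)(p) = diag(1, p, …, p, p²)` with `n - 2` middle diagonal entries equal to `p`. -/
def Dmat (n p : ℕ) : Matrix (Fin n) (Fin n) ℤ :=
  Matrix.diagonal (fun i => if i.val = 0 then 1 else if i.val = n - 1 then (p : ℤ) ^ 2 else (p : ℤ))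

/-- The set `R₀^(n)(p)` of upper-triangular integer matrices whose determinantal divisors are
`d_k = p^(k-1)` for `1 ≤ k ≤ n - 1` and `d_n = p^n`, whose diagonal entries all equal `p`, and
whose above-diagonal entries lie in `[0, p)`. -/
def R0 (n p : ℕ) : Set (Matrix (Fin n) (Fin n) ℤ) :=
  {C | (∀ i j : Fin n, j < i → C i j = 0) ∧
    (∀ k : ℕ, 1 ≤ k → k ≤ n - 1 → detDiv n k C = (p : ℤ) ^ (k - 1)) ∧
    detDiv n n C = (p : ℤ) ^ n ∧
    (∀ i : Fin n, C i i = (p : ℤ)) ∧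
    (∀ i j : Fin n, i < j → 0 ≤ C i j ∧ C i j < (p : ℤ))}

/-- The set `R₁^(n)(p)` of upper-triangular integer matrices whose diagonal entries lie in
`{1, p, p²}` with exactly one entry `1` and exactly one entry `p²`, whose above-diagonal
entries satisfy `0 ≤ c i j < c j j`, and such that `p ∣ c i i` implies `p ∣ c i j` for `j > i`. -/
def R1 (n p : ℕ) : Set (Matrix (Fin n) (Fin n) ℤ) :=
  {C | (∀ i j : Fin n, j < i → C i j = 0) ∧
    (∀ i : Fin n, C i i = 1 ∨ C i i = (p : ℤ) ∨ C i i = (p : ℤ) ^ 2) ∧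
    (∃! i : Fin n, C i i = 1) ∧
    (∃! i : Fin n, C i i = (p : ℤ) ^ 2) ∧
    (∀ i j : Fin n, i < j → 0 ≤ C i j ∧ C i j < C j j) ∧
    (∀ i j : Fin n, i < j → (p : ℤ) ∣ C i i → (p : ℤ) ∣ C i j)}

/-- Casting an integer matrix to a rational matrix. -/
def toQ (n : ℕ) (C : Matrix (Fin n) (Fin n) ℤ) : Matrix (Fin n) (Fin n) ℚ :=
  C.map (fun z : ℤ => (z : ℚ))


theorem exists_eq_mul_diagonal_mul {n : ℕ} (A : Matrix (Fin n) (Fin n) ℤ) (hA : A.det ≠ 0) :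
    ∃ (U V : Matrix (Fin n) (Fin n) ℤ) (s : Fin n → ℤ),
      IsUnit U.det ∧ IsUnit V.det ∧ A = U * diagonal s * V := by
  have hinj : Function.Injective A.mulVecLin := by
    rw [← LinearMap.ker_eq_bot, LinearMap.ker_eq_bot']
    intro v hv
    by_contra h0
    exact hA (Matrix.exists_mulVec_eq_zero_iff.mp ⟨v, h0, hv⟩)
  let E := LinearEquiv.ofInjective A.mulVecLin hinj
  obtain ⟨b, s, c, hc⟩ := Submodule.exists_smith_normal_form_of_rank_eq
    (Pi.basisFun ℤ (Fin n)) E.finrank_eq.symm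
  let d := (Pi.basisFun ℤ (Fin n)).map E
  have hu : ∀ {M : Type} [AddCommGroup M] [Module ℤ M] (e f : Module.Basis (Fin n) ℤ M),
      IsUnit (e.toMatrix f).det := by
    intro M _ _ e f
    refine (Matrix.isUnit_iff_isUnit_det _).mp ?_
    exact isUnit_iff_exists.mpr ⟨f.toMatrix e, Module.Basis.toMatrix_mul_toMatrix_flip e f,
      Module.Basis.toMatrix_mul_toMatrix_flip f e⟩
  refine ⟨(Pi.basisFun ℤ (Fin n)).toMatrix b, c.toMatrix d, s, hu _ _, hu _ _, ?_⟩
  ext i j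
  have h1 : ((d j : LinearMap.range A.mulVecLin) : Fin n → ℤ) i = A i j := by
    simp [d, E]
  have h2 := c.sum_toMatrix_smul_self d j
  rw [← h1, ← h2, Matrix.mul_apply, Submodule.coe_sum, Finset.sum_apply]
  simp only [Submodule.coe_smul, Pi.smul_apply, hc, smul_eq_mul, Matrix.mul_diagonal,
    Module.Basis.toMatrix_apply (Pi.basisFun ℤ (Fin n)), Pi.basisFun_repr]
  refine Finset.sum_congr rfl fun k _ => by ring

theorem pow_dvd_det_of_map_eq_vecMulVec {k p : ℕ} (A : Matrix (Fin (k + 1)) (Fin (k + 1)) ℤ)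
    (u v : Fin (k + 1) → ZMod p) (hp : p ≠ 0)
    (h : A.map (Int.cast : ℤ → ZMod p) = vecMulVec u v) : (p : ℤ) ^ k ∣ A.det := by
  have : NeZero p := ⟨hp⟩
  choose u' hu' using fun i => ZMod.intCast_surjective (u i)
  choose v' hv' using fun i => ZMod.intCast_surjective (v i)
  have hE : ∀ i j, ∃ e : ℤ, A i j = p * e + u' i * v' j := by
    intro i j
    have h1 := congrFun (congrFun h i) j
    simp only [map_apply, vecMulVec_apply, ← hu', ← hv', ← Int.cast_mul] at h1
    rw [ZMod.intCast_eq_intCast_iff_dvd_sub] at h1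
    obtain ⟨e, he⟩ := h1
    exact ⟨-e, by linarith⟩
  choose E hE using hE
  have hA : A = (p : ℤ) • of E - replicateCol Unit u' * (-replicateRow Unit v') := by
    ext i j
    simp [hE, Matrix.mul_apply]
  have h2 : fromBlocks ((p : ℤ) • of E) ((p : ℤ) • replicateCol Unit u') (-replicateRow Unit v')
      ((p : ℤ) • (1 : Matrix Unit Unit ℤ)) =
      fromBlocks ((p : ℤ) • of E) (replicateCol Unit u') (-replicateRow Unit v') 1 *
        fromBlocks 1 0 0 ((p : ℤ) • (1 : Matrix Unit Unit ℤ)) := by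
    simp only [fromBlocks_multiply, Matrix.mul_smul, Matrix.mul_one, Matrix.mul_zero,
      add_zero, zero_add]
  have h3 : fromBlocks ((p : ℤ) • of E) ((p : ℤ) • replicateCol Unit u') (-replicateRow Unit v')
      ((p : ℤ) • (1 : Matrix Unit Unit ℤ)) =
      fromBlocks ((p : ℤ) • (1 : Matrix (Fin (k + 1)) (Fin (k + 1)) ℤ)) 0 0 1 *
      fromBlocks (of E) (replicateCol Unit u') (-replicateRow Unit v')
        ((p : ℤ) • (1 : Matrix Unit Unit ℤ)) := by
    simp only [fromBlocks_multiply, Matrix.mul_smul, Matrix.smul_mul, Matrix.mul_one,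
      Matrix.one_mul, Matrix.zero_mul, smul_zero, add_zero, zero_add]
  have h4 := congrArg det (h2.symm.trans h3)
  rw [det_mul, det_mul, det_fromBlocks_one₂₂, ← hA] at h4
  simp only [det_fromBlocks_zero₂₁, det_one, one_mul, det_smul, Fintype.card_fin, mul_one,
    Fintype.card_unit, pow_one] at h4
  rw [pow_succ', mul_assoc, mul_comm] at h4
  exact ⟨_, mul_left_cancel₀ (Int.natCast_ne_zero.mpr hp) h4⟩

theorem detDiv_dvd {n k : ℕ} (C : Matrix (Fin n) (Fin n) ℤ) {f g : Fin k → Fin n}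
    (hf : StrictMono f) (hg : StrictMono g) : detDiv n k C ∣ (C.submatrix f g).det := by
  refine Finset.gcd_dvd (f := fun fg : (Fin k → Fin n) × (Fin k → Fin n) =>
    (C.submatrix fg.1 fg.2).det) (b := (f, g)) ?_
  exact Finset.mem_filter.mpr ⟨Finset.mem_univ _, fun _ _ h => hf h, fun _ _ h => hg h⟩

theorem dvd_detDiv {n k : ℕ} (C : Matrix (Fin n) (Fin n) ℤ) {d : ℤ}
    (h : ∀ f g : Fin k → Fin n, StrictMono f → StrictMono g → d ∣ (C.submatrix f g).det) :
    d ∣ detDiv n k C := by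
  refine Finset.dvd_gcd fun fg hfg => ?_
  obtain ⟨-, hf, hg⟩ := Finset.mem_filter.mp hfg
  exact h _ _ (fun _ _ h => hf _ _ h) (fun _ _ h => hg _ _ h)

theorem detDiv_eq_pow {n k p m : ℕ} (C : Matrix (Fin n) (Fin n) ℤ)
    (h1 : detDiv n k C ∣ (p : ℤ) ^ m) (h2 : (p : ℤ) ^ m ∣ detDiv n k C) :
    detDiv n k C = (p : ℤ) ^ m :=
  dvd_antisymm_of_normalize_eq (Finset.normalize_gcd)
    (Int.normalize_of_nonneg (by positivity)) h1 h2

/-- The entries above the diagonal in column `b` of the adjugate of an upper triangular matrix with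
constant diagonal `p` whose strictly upper part vanishes in the columns before `b`. -/
theorem adjugate_apply_of_upperTriangular {m p : ℕ} (hp : p ≠ 0)
    (A : Matrix (Fin (m + 2)) (Fin (m + 2)) ℤ) (hU : ∀ i j, j < i → A i j = 0)
    (hD : ∀ i, A i i = p) {a b : Fin (m + 2)} (hab : a < b)
    (hb : ∀ i j, i < j → j < b → A i j = 0) :
    A.adjugate a b = -((p : ℤ) ^ m * A a b) := by
  let x : Fin (m + 2) → ℤ := fun i =>
    if i < b then -((p : ℤ) ^ m * A i b) else if i = b then (p : ℤ) ^ (m + 1) else 0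
  have hdet : A.det = (p : ℤ) ^ (m + 2) := by
    rw [det_of_isUpperTriangular (fun i j h => hU i j h)]
    simp [hD]
  have hx : A *ᵥ x = (p : ℤ) ^ (m + 2) • Pi.single b 1 := by
    ext i
    have hterm : ∀ j, A i j * x j = (if j = i then p * x i else 0) +
        (if j = b then (if i < b then A i b * (p : ℤ) ^ (m + 1) else 0) else 0) := by
      intro j
      rcases lt_trichotomy j i with hji | rfl | hij
      · rw [hU i j hji, if_neg hji.ne]
        by_cases hjb : j = b
        · subst hjb; simp [hji.not_gt]
        · simp [hjb]
      · rw [hD, if_pos rfl]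
        by_cases hjb : j = b
        · subst hjb; simp
        · simp [hjb]
      · rw [if_neg hij.ne']
        rcases lt_trichotomy j b with hjb | rfl | hjb
        · simp [hb i j hij hjb, hjb.ne]
        · simp [x, hij]
        · simp [x, hjb.not_gt, hjb.ne']
    rw [mulVec, dotProduct, Finset.sum_congr rfl fun j _ => hterm j, Finset.sum_add_distrib]
    simp only [Finset.sum_ite_eq', Finset.mem_univ, if_true, x, Pi.smul_apply, smul_eq_mul]
    rcases lt_trichotomy i b with h | rfl | h
    · simp [h, h.ne]; ring
    · simp; ring
    · simp [h.not_gt, h.ne']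
  have h1 := congrArg (A.adjugate *ᵥ ·) hx
  simp only [mulVec_mulVec, adjugate_mul, hdet, mulVec_smul, smul_mulVec, one_mulVec,
    mulVec_single_one] at h1
  have h2 := congrFun h1 a
  simp only [Pi.smul_apply, smul_eq_mul, col_apply] at h2
  have h3 := mul_left_cancel₀ (by positivity) h2
  rw [← h3]
  simp [x, hab]

theorem mem_R0_of_vecMulVec {n p : ℕ} (hp : p.Prime) (C : Matrix (Fin n) (Fin n) ℤ)
    (hU : ∀ i j, j < i → C i j = 0) (hD : ∀ i, C i i = p)
    (hR : ∀ i j : Fin n, i < j → 0 ≤ C i j ∧ C i j < (p : ℤ))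
    (u v : Fin n → ZMod p) (huv : C.map (Int.cast : ℤ → ZMod p) = vecMulVec u v)
    {a b : Fin n} (hab : ¬ (p : ℤ) ∣ C a b) (hb : ∀ i j, i < j → j < b → C i j = 0) :
    C ∈ R0 n p := by
  have hlt : a < b := by
    rcases lt_trichotomy a b with h | rfl | h
    · exact h
    · simp [hD] at hab
    · simp [hU a b h] at hab
  have hdetf : ∀ {k : ℕ} (f : Fin k → Fin n), StrictMono f →
      (C.submatrix f f).det = (p : ℤ) ^ k := by
    intro k f hf
    rw [det_of_isUpperTriangular (M := C.submatrix f f) (fun i j h => hU _ _ (hf h))]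
    simp [hD]
  refine ⟨hU, ?_, ?_, hD, hR⟩
  · rintro k hk1 hkn
    obtain ⟨m, rfl⟩ : ∃ m, k = m + 1 := ⟨k - 1, by omega⟩
    rw [Nat.add_sub_cancel]
    refine detDiv_eq_pow C ?_ (dvd_detDiv C fun f g _ _ =>
      pow_dvd_det_of_map_eq_vecMulVec _ (u ∘ f) (v ∘ g) hp.ne_zero ?_)
    · have h1 : detDiv n (m + 1) C ∣ (p : ℤ) ^ m * p := by
        rw [← pow_succ, ← hdetf _ (Fin.strictMono_castLE (by omega : m + 1 ≤ n))]
        exact detDiv_dvd C (Fin.strictMono_castLE _) (Fin.strictMono_castLE _)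
      have h2 : detDiv n (m + 1) C ∣ (p : ℤ) ^ m * C a b := by
        obtain ⟨S, hS, -, hcard⟩ := Finset.exists_subsuperset_card_eq
          (Finset.subset_univ ({a, b} : Finset (Fin n))) (n := m + 2)
          (by rw [Finset.card_pair hlt.ne]; omega) (by simp; omega)
        have hmem : ∀ c ∈ S, ∃ c', S.orderEmbOfFin hcard c' = c := by
          intro c hc
          have : c ∈ Set.range (S.orderEmbOfFin hcard) := by simpa using hc
          exact this
        obtain ⟨a', ha'⟩ := hmem a (hS (by simp))
        obtain ⟨b', hb'⟩ := hmem b (hS (by simp))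
        have hf := (S.orderEmbOfFin hcard).strictMono
        set f := S.orderEmbOfFin hcard
        have h3 := adjugate_apply_of_upperTriangular hp.ne_zero (C.submatrix f f)
          (fun i j h => hU _ _ (hf h)) (fun i => hD _) (a := a') (b := b')
          (hf.lt_iff_lt.mp (by rwa [ha', hb']))
          (fun i j h h' => hb _ _ (hf h) (by rw [← hb']; exact hf h'))
        rw [adjugate_fin_succ_eq_det_submatrix, submatrix_submatrix, submatrix_apply, ha', hb'] at h3
        rw [← dvd_neg, ← h3]
        exact Dvd.dvd.mul_left (detDiv_dvd C (hf.comp (Fin.strictMono_succAbove _))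
          (hf.comp (Fin.strictMono_succAbove _))) _
      have hco : IsCoprime (p : ℤ) (C a b) :=
        (Nat.prime_iff_prime_int.mp hp).irreducible.coprime_iff_not_dvd.mpr hab
      obtain ⟨s, t, hst⟩ := hco
      have h4 : (p : ℤ) ^ m = s * ((p : ℤ) ^ m * p) + t * ((p : ℤ) ^ m * C a b) := by
        linear_combination (-(p : ℤ) ^ m) * hst
      rw [h4]
      exact dvd_add (h1.mul_left _) (h2.mul_left _)
    · ext i j
      exact congrFun (congrFun huv (f i)) (g j)
  · have hid : ∀ f : Fin n → Fin n, StrictMono f → f = id := fun f hf =>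
      (hf.range_inj strictMono_id).mp
        (by rw [(Finite.injective_iff_surjective.mp hf.injective).range_eq, Set.range_id])
    have hdet := hdetf id strictMono_id
    refine detDiv_eq_pow C ?_ (dvd_detDiv C fun f g hf hg => ?_)
    · rw [← hdet]
      exact detDiv_dvd C strictMono_id strictMono_id
    · rw [hid f hf, hid g hg, hdet]

theorem exists_vecMulVec_of_detDiv_two {n p : ℕ} (hp : p.Prime) (C : Matrix (Fin n) (Fin n) ℤ)
    (h : detDiv n 2 C = p) : ∃ u v : Fin n → ZMod p,
      C.map (Int.cast : ℤ → ZMod p) = vecMulVec u v := by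
  have := Fact.mk hp
  have hlt : ∀ i i' j j', i < i' → j < j' →
      (C i j : ZMod p) * C i' j' = C i j' * C i' j := by
    intro i i' j j' hi hj
    have h1 := detDiv_dvd C (f := ![i, i']) (g := ![j, j'])
      (by simpa [Fin.strictMono_iff_lt_succ] using hi)
      (by simpa [Fin.strictMono_iff_lt_succ] using hj)
    rw [h, det_fin_two, ← ZMod.intCast_zmod_eq_zero_iff_dvd] at h1
    simpa [sub_eq_zero] using h1
  have hall : ∀ i i' j j', (C i j : ZMod p) * C i' j' = C i j' * C i' j := by
    intro i i' j j'
    rcases lt_trichotomy i i' with hi | rfl | hi <;> rcases lt_trichotomy j j' with hj | rfl | hj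
    · exact hlt _ _ _ _ hi hj
    · rfl
    · exact (hlt _ _ _ _ hi hj).symm
    · ring
    · ring
    · ring
    · linear_combination -hlt _ _ _ _ hi hj
    · ring
    · linear_combination hlt _ _ _ _ hi hj
  by_cases h0 : ∃ i j, (C i j : ZMod p) ≠ 0
  · obtain ⟨i, j, hij⟩ := h0
    refine ⟨fun i' => C i' j, fun j' => C i j' / C i j, ?_⟩
    ext i' j'
    rw [map_apply, vecMulVec_apply, ← mul_div_assoc, eq_div_iff hij]
    linear_combination hall i' i j' j
  · push Not at h0
    exact ⟨0, 0, by ext i j; simp [h0]⟩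

theorem exists_perm_comp_eq {n : ℕ} {e t : Fin n → ℕ} (he : ∀ i, e i ≤ 2) (ht : ∀ i, t i ≤ 2)
    (h0 : (Finset.univ.filter fun i => e i = 0).card = (Finset.univ.filter fun i => t i = 0).card)
    (hsum : ∑ i, e i = ∑ i, t i) : ∃ σ : Equiv.Perm (Fin n), e ∘ σ = t := by
  have key : ∀ f : Fin n → ℕ, (∀ i, f i ≤ 2) →
      ∑ i, f i = (Finset.univ.filter fun i => f i = 1).card +
        2 * (Finset.univ.filter fun i => f i = 2).card ∧
      n = (Finset.univ.filter fun i => f i = 0).card +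
        (Finset.univ.filter fun i => f i = 1).card +
        (Finset.univ.filter fun i => f i = 2).card ∧
      ∀ c, 2 < c → (Finset.univ.filter fun i => f i = c).card = 0 := by
    intro f hf
    refine ⟨?_, ?_, ?_⟩
    · simp only [Finset.card_filter, Finset.mul_sum, ← Finset.sum_add_distrib]
      refine Finset.sum_congr rfl fun i _ => ?_
      have := hf i
      interval_cases f i <;> simp
    · conv_lhs => rw [← Fintype.card_fin n, Fintype.card_eq_sum_ones]
      simp only [Finset.card_filter, ← Finset.sum_add_distrib]
      refine Finset.sum_congr rfl fun i _ => ?_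
      have := hf i
      interval_cases f i <;> simp
    · intro c hc
      rw [Finset.card_eq_zero, Finset.filter_eq_empty_iff]
      intro i _
      have := hf i
      omega
  obtain ⟨h1, h2, h3⟩ := key e he
  obtain ⟨h4, h5, h6⟩ := key t ht
  have hc : ∀ c, Fintype.card {i // t i = c} = Fintype.card {i // e i = c} := by
    intro c
    rw [Fintype.card_subtype, Fintype.card_subtype]
    by_cases hc : 2 < c
    · rw [h3 c hc, h6 c hc]
    · have : c ≤ 2 := by omega
      interval_cases c <;> omega
  exact ⟨Equiv.ofFiberEquiv fun c => Fintype.equivOfCardEq (hc c),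
    funext fun i => Equiv.ofFiberEquiv_map _ i⟩

/-- The exponents `0, 0, 1, …, 1, 2, 2`. -/
def outerExponent (n : ℕ) (i : Fin n) : ℕ :=
  if i.val ≤ 1 then 0 else if n - 2 ≤ i.val then 2 else 1

theorem card_outerExponent_eq_zero {n : ℕ} (hn : 4 ≤ n) :
    (Finset.univ.filter fun i => outerExponent n i = 0).card = 2 := by
  have h : (Finset.univ.filter fun i => outerExponent n i = 0) =
      {⟨0, by omega⟩, ⟨1, by omega⟩} := by
    ext i
    simp [outerExponent, Fin.ext_iff]
    grind
  rw [h, Finset.card_pair (by simp)]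

theorem sum_outerExponent {n : ℕ} (hn : 4 ≤ n) : ∑ i, outerExponent n i = n := by
  have h2 : (Finset.univ.filter fun i : Fin n => n - 2 ≤ i.val) =
      {⟨n - 2, by omega⟩, ⟨n - 1, by omega⟩} := by
    ext i
    simp [Fin.ext_iff]
    omega
  have h3 : ∑ i, (outerExponent n i + if outerExponent n i = 0 then 1 else 0) =
      ∑ i : Fin n, (1 + if n - 2 ≤ i.val then 1 else 0) := by
    refine Finset.sum_congr rfl fun i _ => ?_
    unfold outerExponent
    split_ifs <;> simp_all
    omega
  rw [Finset.sum_add_distrib, Finset.sum_add_distrib, ← Finset.card_filter, ← Finset.card_filter,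
    card_outerExponent_eq_zero hn, h2, Finset.card_pair (by simp; omega)] at h3
  simpa using h3

theorem exists_eq_mul_outerExponent_mul {n p : ℕ} (hn : 4 ≤ n) [Fact p.Prime]
    (M B : Matrix (Fin n) (Fin n) ℤ) (hdet : M.det = (p : ℤ) ^ n)
    (hMB : M * B = (p : ℤ) ^ 2 • (1 : Matrix (Fin n) (Fin n) ℤ))
    (hrank : (M.map (Int.cast : ℤ → ZMod p)).rank = 2) :
    ∃ U V : Matrix (Fin n) (Fin n) ℤ, IsUnit U.det ∧ IsUnit V.det ∧
      M = U * diagonal (fun i => (p : ℤ) ^ outerExponent n i) * V := by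
  have hp : p.Prime := Fact.out
  have hp0 : (p : ℤ) ≠ 0 := Int.natCast_ne_zero.mpr hp.ne_zero
  obtain ⟨U, V, s, hU, hV, hM⟩ := exists_eq_mul_diagonal_mul M (by rw [hdet]; positivity)
  have hdvd : ∀ i, s i ∣ (p : ℤ) ^ 2 := by
    intro i
    have h1 : diagonal s * (V * B * U) = (p : ℤ) ^ 2 • (1 : Matrix (Fin n) (Fin n) ℤ) := by
      apply ((Matrix.isUnit_iff_isUnit_det U).mpr hU).mul_left_cancel
      calc U * (diagonal s * (V * B * U)) = (U * diagonal s * V) * B * U := by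
            simp only [Matrix.mul_assoc]
        _ = _ := by rw [← hM, hMB, Matrix.smul_mul, Matrix.mul_smul, Matrix.one_mul, Matrix.mul_one]
    have h2 := congrFun (congrFun h1 i) i
    simp only [diagonal_mul, Matrix.smul_apply, one_apply_eq, smul_eq_mul, mul_one] at h2
    exact ⟨_, h2.symm⟩
  have hs0 : ∀ i, s i ≠ 0 := fun i h => by
    have := hdvd i
    rw [h, zero_dvd_iff] at this
    exact pow_ne_zero 2 hp0 this
  have hex : ∀ i, ∃ e ≤ 2, (s i).natAbs = p ^ e := fun i =>
    (Nat.dvd_prime_pow hp).mp (by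
      have := Int.natAbs_dvd_natAbs.mpr (hdvd i)
      rwa [Int.natAbs_pow, Int.natAbs_natCast] at this)
  choose e he hse using hex
  have hsum : ∑ i, e i = n := by
    have h1 := congrArg Int.natAbs (congrArg det hM)
    rw [hdet, det_mul, det_mul, det_diagonal, Int.natAbs_mul, Int.natAbs_mul,
      Int.isUnit_iff_natAbs_eq.mp hU, Int.isUnit_iff_natAbs_eq.mp hV, one_mul, mul_one,
      Int.natAbs_pow, Int.natAbs_natCast, ← Int.natAbsHom_apply, map_prod] at h1
    simp only [Int.natAbsHom_apply, hse, Finset.prod_pow_eq_pow_sum] at h1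
    exact (Nat.pow_right_injective hp.two_le h1).symm
  have hcard : (Finset.univ.filter fun i => e i = 0).card = 2 := by
    have h1 : M.map (Int.cast : ℤ → ZMod p) = U.map (Int.cast : ℤ → ZMod p) *
        diagonal (fun i => (s i : ZMod p)) * V.map (Int.cast : ℤ → ZMod p) := by
      have := congrArg (Int.castRingHom (ZMod p)).mapMatrix hM
      rw [map_mul, map_mul] at this
      simpa [RingHom.mapMatrix_apply, diagonal_map] using this
    have hu : ∀ W : Matrix (Fin n) (Fin n) ℤ, IsUnit W.det →
        IsUnit (W.map (Int.cast : ℤ → ZMod p)).det := by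
      intro W hW
      have := hW.map (Int.castRingHom (ZMod p))
      rwa [RingHom.map_det] at this
    rw [h1, rank_mul_eq_left_of_isUnit_det _ _ (hu V hV), rank_mul_eq_right_of_isUnit_det _ _ (hu U hU),
      rank_diagonal, Fintype.card_subtype] at hrank
    rw [← hrank]
    congr 1
    ext i
    simp only [Finset.mem_filter, Finset.mem_univ, true_and, ne_eq]
    rw [ZMod.intCast_zmod_eq_zero_iff_dvd, Int.natCast_dvd, hse]
    constructor
    · intro h; simp [h, hp.one_lt.ne']
    · intro h
      by_contra h'
      exact h (dvd_pow_self p h')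
  obtain ⟨σ, hσ⟩ := exists_perm_comp_eq (t := outerExponent n) he
    (fun i => by unfold outerExponent; split_ifs <;> omega)
    (by rw [hcard, card_outerExponent_eq_zero hn]) (by rw [hsum, sum_outerExponent hn])
  have hsign : ∀ i, IsUnit (s i).sign := fun i => by
    rw [Int.isUnit_iff_natAbs_eq, Int.natAbs_sign_of_ne_zero (hs0 i)]
  have hperm : ∀ τ : Equiv.Perm (Fin n), IsUnit ((Equiv.Perm.sign τ : ℤˣ) : ℤ) := fun τ =>
    Units.isUnit _
  refine ⟨(U * diagonal fun i => (s i).sign).submatrix id σ, V.submatrix σ id, ?_, ?_, ?_⟩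
  · rw [det_permute', det_mul, det_diagonal]
    exact (hperm σ).mul (hU.mul (IsUnit.prod_univ_iff.mpr hsign))
  · rw [det_permute]
    exact (hperm σ).mul hV
  · have h1 : diagonal (fun i => (p : ℤ) ^ outerExponent n i) =
        (diagonal fun i => (p : ℤ) ^ e i).submatrix σ σ := by
      rw [submatrix_diagonal_equiv]
      congr 1
      ext i
      rw [← hσ]; rfl
    rw [h1, submatrix_mul_equiv, submatrix_mul_equiv, Matrix.mul_assoc U, diagonal_mul_diagonal,
      submatrix_id_id, hM]
    congr 3
    ext i
    rw [← Nat.cast_pow, ← hse, Int.sign_mul_natAbs]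

/-- The integral matrix `p⁻¹ C D`, for `C` upper triangular with constant diagonal `p` and `D` the
diagonal matrix `Dmat n p`. -/
def scaledProduct (n p : ℕ) (C : Matrix (Fin n) (Fin n) ℤ) : Matrix (Fin n) (Fin n) ℤ :=
  of fun i j => if j.val = 0 then (if i.val = 0 then 1 else 0)
    else if j.val = n - 1 then p * C i j else C i j

theorem mul_Dmat_eq_smul {n p : ℕ} (hn : 4 ≤ n) (C : Matrix (Fin n) (Fin n) ℤ)
    (hU : ∀ i j, j < i → C i j = 0) (hD : ∀ i, C i i = p) :
    C * Dmat n p = (p : ℤ) • scaledProduct n p C := by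
  ext i j
  rw [Dmat, mul_diagonal, Matrix.smul_apply, scaledProduct, of_apply]
  by_cases hj : j.val = 0
  · by_cases hi : i.val = 0
    · obtain rfl : i = j := Fin.ext (by omega)
      simp [hj, hD]
    · simp [hj, hi, hU i j (Fin.lt_def.mpr (by omega))]
  · by_cases hj' : j.val = n - 1
    · simp only [hj', if_true, smul_eq_mul]
      rw [if_neg (by omega), if_neg (by omega)]
      ring
    · simp [hj, hj', mul_comm]

theorem map_scaledProduct {n p : ℕ} (hn : 4 ≤ n) (C : Matrix (Fin n) (Fin n) ℤ)
    (u v : Fin n → ZMod p) (huv : C.map (Int.cast : ℤ → ZMod p) = vecMulVec u v) :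
    (scaledProduct n p C).map (Int.cast : ℤ → ZMod p) =
      vecMulVec (Pi.single ⟨0, by omega⟩ 1) (Pi.single ⟨0, by omega⟩ 1) +
        vecMulVec u (fun j => if j.val = 0 ∨ j.val = n - 1 then 0 else v j) := by
  ext i j
  have h := congrFun (congrFun huv i) j
  simp only [map_apply, vecMulVec_apply, Matrix.add_apply, scaledProduct, of_apply,
    Pi.single_apply, Fin.ext_iff] at h ⊢
  by_cases hj : j.val = 0
  · by_cases hi : i.val = 0 <;> simp [hj, hi]
  · by_cases hj' : j.val = n - 1
    · have : ¬ n - 1 = 0 := by omega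
      simp [hj', this]
    · simp [hj, hj', h]

theorem rank_scaledProduct {n p : ℕ} (hn : 4 ≤ n) [Fact p.Prime] (C : Matrix (Fin n) (Fin n) ℤ)
    (u v : Fin n → ZMod p) (huv : C.map (Int.cast : ℤ → ZMod p) = vecMulVec u v)
    {i₀ j₀ : Fin n} (hi : i₀.val ≠ 0) (hj : j₀.val ≠ 0) (hj' : j₀.val ≠ n - 1)
    (hC : (C i₀ j₀ : ZMod p) ≠ 0) :
    ((scaledProduct n p C).map (Int.cast : ℤ → ZMod p)).rank = 2 := by
  refine le_antisymm ?_ ?_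
  · have h : ∀ a b c d : Fin n → ZMod p, vecMulVec a b + vecMulVec c d =
        (of ![a, c])ᵀ * of ![b, d] := by
      intro a b c d
      ext i j
      simp [Matrix.mul_apply, vecMulVec_apply]
    rw [map_scaledProduct hn C u v huv, h]
    exact (rank_mul_le_left _ _).trans (by simpa using rank_le_width (of ![_, u])ᵀ)
  · have h1 := rank_submatrix_le ((scaledProduct n p C).map (Int.cast : ℤ → ZMod p))
      ![⟨0, by omega⟩, i₀] ![⟨0, by omega⟩, j₀]
    rwa [rank_of_isUnit _ ((Matrix.isUnit_iff_isUnit_det _).mpr (by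
      rw [det_fin_two]
      simpa [scaledProduct, hi, hj, hj'] using hC)), Fintype.card_fin] at h1

theorem det_Dmat {n p : ℕ} (hn : 4 ≤ n) : (Dmat n p).det = (p : ℤ) ^ n := by
  obtain ⟨m, rfl⟩ : ∃ m, n = m + 2 := ⟨n - 2, by omega⟩
  rw [Dmat, det_diagonal, Fin.prod_univ_succ, Fin.prod_univ_castSucc]
  simp only [Fin.val_zero, if_true, Fin.val_succ, Fin.val_castSucc, Fin.val_last]
  rw [Finset.prod_congr rfl (g := fun _ => (p : ℤ)) fun i _ => by
    rw [if_neg (by omega), if_neg (by omega)]]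
  simp
  ring

theorem det_scaledProduct {n p : ℕ} (hn : 4 ≤ n) (hp : p ≠ 0) (C : Matrix (Fin n) (Fin n) ℤ)
    (hU : ∀ i j, j < i → C i j = 0) (hD : ∀ i, C i i = p) :
    (scaledProduct n p C).det = (p : ℤ) ^ n := by
  have h := congrArg det (mul_Dmat_eq_smul hn C hU hD)
  rw [det_mul, det_Dmat hn, det_smul, det_of_isUpperTriangular (fun i j h => hU i j h)] at h
  simp only [hD, Finset.prod_const, Finset.card_univ, Fintype.card_fin] at h
  exact (mul_left_cancel₀ (by positivity) h).symm

theorem exists_mul_eq_sq_smul_one {n p : ℕ} (hn : 4 ≤ n) (hp : p ≠ 0)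
    (C : Matrix (Fin n) (Fin n) ℤ) (hU : ∀ i j, j < i → C i j = 0) (hD : ∀ i, C i i = p)
    (u v : Fin n → ZMod p) (huv : C.map (Int.cast : ℤ → ZMod p) = vecMulVec u v) :
    ∃ B, C * B = (p : ℤ) ^ 2 • (1 : Matrix (Fin n) (Fin n) ℤ) := by
  obtain ⟨m, rfl⟩ : ∃ m, n = m + 2 := ⟨n - 2, by omega⟩
  have hdvd : ∀ i j, (p : ℤ) ^ m ∣ C.adjugate i j := by
    intro i j
    rw [adjugate_fin_succ_eq_det_submatrix]
    refine Dvd.dvd.mul_left (pow_dvd_det_of_map_eq_vecMulVec _ (u ∘ j.succAbove)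
      (v ∘ i.succAbove) hp ?_) _
    ext i' j'
    exact congrFun (congrFun huv _) _
  choose B hB using hdvd
  have hadj : C.adjugate = (p : ℤ) ^ m • of B := by
    ext i j
    simp [hB]
  have h := mul_adjugate C
  rw [hadj, det_of_isUpperTriangular (fun i j h => hU i j h), Matrix.mul_smul] at h
  simp only [hD, Finset.prod_const, Finset.card_univ, Fintype.card_fin] at h
  rw [pow_add, mul_smul] at h
  exact ⟨of B, smul_right_injective _ (r := (p : ℤ) ^ m) (by positivity) h⟩

theorem exists_scaledProduct_mul_eq {n p : ℕ} (hn : 4 ≤ n) (hp : p ≠ 0)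
    (C : Matrix (Fin n) (Fin n) ℤ) (hU : ∀ i j, j < i → C i j = 0) (hD : ∀ i, C i i = p)
    (u v : Fin n → ZMod p) (huv : C.map (Int.cast : ℤ → ZMod p) = vecMulVec u v) :
    ∃ B, scaledProduct n p C * B = (p : ℤ) ^ 2 • (1 : Matrix (Fin n) (Fin n) ℤ) := by
  have hp0 : (p : ℤ) ≠ 0 := Int.natCast_ne_zero.mpr hp
  obtain ⟨B, hB⟩ := exists_mul_eq_sq_smul_one hn hp C hU hD u v huv
  have hlast : ∀ i j : Fin n, i.val = n - 1 → B i j = p * (1 : Matrix (Fin n) (Fin n) ℤ) i j := by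
    intro i j hi
    have h := congrFun (congrFun hB i) j
    rw [Matrix.mul_apply, Finset.sum_eq_single i (fun k _ hk => by
      rw [hU i k (by rw [Fin.lt_def]; have := Fin.val_ne_of_ne hk; omega), zero_mul]) (by simp),
      hD, Matrix.smul_apply, smul_eq_mul, pow_two, mul_assoc] at h
    exact mul_left_cancel₀ hp0 h
  let B' : Matrix (Fin n) (Fin n) ℤ := of fun i j =>
    if i.val = 0 then p * B i j
    else if i.val = n - 1 then (1 : Matrix (Fin n) (Fin n) ℤ) i j else B i j
  have hDB : Dmat n p * B' = (p : ℤ) • B := by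
    ext i j
    rw [Dmat, diagonal_mul, Matrix.smul_apply, smul_eq_mul]
    simp only [B', of_apply]
    split_ifs with h1 h2
    · ring
    · rw [hlast i j h2]; ring
    · ring
  refine ⟨B', smul_right_injective _ hp0 ?_⟩
  simp only
  rw [← Matrix.smul_mul, ← mul_Dmat_eq_smul hn C hU hD, Matrix.mul_assoc, hDB, Matrix.mul_smul, hB]

theorem toQ_mul {n : ℕ} (A B : Matrix (Fin n) (Fin n) ℤ) : toQ n (A * B) = toQ n A * toQ n B :=
  map_mul (Int.castRingHom ℚ).mapMatrix A B

theorem det_toQ {n : ℕ} (A : Matrix (Fin n) (Fin n) ℤ) : (toQ n A).det = (A.det : ℚ) :=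
  ((Int.castRingHom ℚ).map_det A).symm

theorem toQ_injective {n : ℕ} : Function.Injective (toQ n) :=
  Matrix.map_injective Int.cast_injective

theorem mem_Lambda_iff {n : ℕ} {γ : Matrix (Fin n) (Fin n) ℚ} :
    γ ∈ Lambda n ↔ ∃ U : Matrix (Fin n) (Fin n) ℤ, IsUnit U.det ∧ toQ n U = γ := by
  constructor
  · rintro ⟨hz, hdet⟩
    choose U hU using hz
    have h : toQ n (of U) = γ := by ext i j; exact (hU i j).symm
    refine ⟨of U, ?_, h⟩
    rw [← h, det_toQ] at hdet
    rw [Int.isUnit_iff]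
    exact_mod_cast hdet
  · rintro ⟨U, hU, rfl⟩
    refine ⟨fun i j => ⟨U i j, rfl⟩, ?_⟩
    rw [det_toQ]
    exact_mod_cast Int.isUnit_iff.mp hU

theorem mem_doubleCoset_iff {n p : ℕ} (hn : 4 ≤ n) (hp : p ≠ 0) (C : Matrix (Fin n) (Fin n) ℤ)
    (hU : ∀ i j, j < i → C i j = 0) (hD : ∀ i, C i i = p) :
    toQ n (C * Dmat n p) ∈ doubleCoset n (Matrix.diagonal fun i : Fin n =>
      if i.val ≤ 1 then (p : ℚ) else if n - 2 ≤ i.val then (p : ℚ) ^ 3 else (p : ℚ) ^ 2) ↔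
    ∃ U V : Matrix (Fin n) (Fin n) ℤ, IsUnit U.det ∧ IsUnit V.det ∧
      scaledProduct n p C = U * diagonal (fun i => (p : ℤ) ^ outerExponent n i) * V := by
  have hG : (Matrix.diagonal fun i : Fin n => if i.val ≤ 1 then (p : ℚ)
      else if n - 2 ≤ i.val then (p : ℚ) ^ 3 else (p : ℚ) ^ 2) =
      toQ n ((p : ℤ) • diagonal (fun i => (p : ℤ) ^ outerExponent n i)) := by
    ext i j
    by_cases h : i = j
    · subst h
      simp only [toQ, diagonal_apply_eq, map_apply, Matrix.smul_apply, outerExponent]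
      split_ifs <;> simp <;> ring
    · simp only [toQ, map_apply, Matrix.smul_apply, diagonal_apply_ne _ h, smul_zero, Int.cast_zero]
  have key : ∀ U V : Matrix (Fin n) (Fin n) ℤ,
      toQ n (C * Dmat n p) = toQ n U *
        toQ n ((p : ℤ) • diagonal (fun i => (p : ℤ) ^ outerExponent n i)) * toQ n V ↔
      scaledProduct n p C = U * diagonal (fun i => (p : ℤ) ^ outerExponent n i) * V := by
    intro U V
    rw [← toQ_mul, ← toQ_mul, toQ_injective.eq_iff, mul_Dmat_eq_smul hn C hU hD, Matrix.mul_smul,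
      Matrix.smul_mul]
    exact (smul_right_injective _ (Int.natCast_ne_zero.mpr hp)).eq_iff
  rw [hG]
  constructor
  · rintro ⟨γ₁, h₁, γ₂, h₂, h⟩
    obtain ⟨U, hU', rfl⟩ := mem_Lambda_iff.mp h₁
    obtain ⟨V, hV', rfl⟩ := mem_Lambda_iff.mp h₂
    exact ⟨U, V, hU', hV', (key U V).mp h⟩
  · rintro ⟨U, V, hU', hV', h⟩
    exact ⟨_, mem_Lambda_iff.mpr ⟨U, hU', rfl⟩, _, mem_Lambda_iff.mpr ⟨V, hV', rfl⟩,
      (key U V).mpr h⟩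

theorem exists_ne_zero_of_mem_doubleCoset {n p : ℕ} (hn : 4 ≤ n) [Fact p.Prime]
    (C U V : Matrix (Fin n) (Fin n) ℤ) (hU : IsUnit U.det) (hV : IsUnit V.det)
    (h : scaledProduct n p C = U * diagonal (fun i => (p : ℤ) ^ outerExponent n i) * V) :
    ∃ i j : Fin n, i.val ≠ 0 ∧ j.val ≠ n - 1 ∧ (C i j : ZMod p) ≠ 0 := by
  have hp : p.Prime := Fact.out
  by_contra! hcon
  have h1 : (U⁻¹ * scaledProduct n p C * V⁻¹) =
      diagonal (fun i => (p : ℤ) ^ outerExponent n i) := by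
    rw [h, Matrix.mul_assoc U, ← Matrix.mul_assoc U⁻¹, nonsing_inv_mul _ hU, Matrix.one_mul,
      Matrix.mul_assoc, mul_nonsing_inv _ hV, Matrix.mul_one]
  have h2 : (scaledProduct n p C).map (Int.cast : ℤ → ZMod p) =
      vecMulVec (Pi.single ⟨0, by omega⟩ 1)
        (fun j => (scaledProduct n p C ⟨0, by omega⟩ j : ZMod p)) := by
    ext i j
    by_cases hi : i.val = 0
    · have : i = ⟨0, by omega⟩ := Fin.ext hi
      simp [vecMulVec_apply, this]
    · have : i ≠ ⟨0, by omega⟩ := fun h => hi (congrArg Fin.val h)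
      simp only [map_apply, vecMulVec_apply, Pi.single_eq_of_ne this, zero_mul]
      simp only [scaledProduct, of_apply, hi, if_false]
      split_ifs with hj hj'
      · simp
      · simp
      · exact hcon i j hi hj'
  have h3 := congrArg (Int.castRingHom (ZMod p)).mapMatrix h1
  rw [map_mul, map_mul, RingHom.mapMatrix_apply _ (scaledProduct n p C)] at h3
  change _ * (scaledProduct n p C).map (Int.cast : ℤ → ZMod p) * _ = _ at h3
  rw [h2, mul_vecMulVec, vecMulVec_mul] at h3
  have hne : ∀ x y : Fin n → ZMod p, vecMulVec x y ≠ (Int.castRingHom (ZMod p)).mapMatrix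
      (diagonal fun i => (p : ℤ) ^ outerExponent n i) := by
    intro x y hxy
    have e := fun i j => congrFun (congrFun hxy i) j
    simp only [vecMulVec_apply, RingHom.mapMatrix_apply, map_apply] at e
    have e00 := e ⟨0, by omega⟩ ⟨0, by omega⟩
    have e01 := e ⟨0, by omega⟩ ⟨1, by omega⟩
    have e11 := e ⟨1, by omega⟩ ⟨1, by omega⟩
    simp [outerExponent] at e00 e01 e11
    rcases e01 with h | h <;> simp [h] at e00 e11
  exact hne _ _ h3

/-- Column factors: supported before `b` and nonzero somewhere below the first row. -/
def columnFactors (n p : ℕ) [NeZero p] (b : Fin n) : Finset (Fin n → ZMod p) :=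
  Finset.univ.filter fun u => (∀ i, b ≤ i → u i = 0) ∧ ∃ i, i.val ≠ 0 ∧ u i ≠ 0

/-- Row factors: vanishing before `b` and equal to `1` at `b`. -/
def rowFactors (n p : ℕ) [NeZero p] (b : Fin n) : Finset (Fin n → ZMod p) :=
  Finset.univ.filter fun v => (∀ j, j < b → v j = 0) ∧ v b = 1

theorem card_piFinset_ite {n p : ℕ} [NeZero p] (P : Fin n → Prop) [DecidablePred P]
    (c : Fin n → ZMod p) :
    (Fintype.piFinset fun i => if P i then (Finset.univ : Finset (ZMod p)) else {c i}).card =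
      p ^ (Finset.univ.filter P).card := by
  rw [Fintype.card_piFinset, ← Finset.prod_const, Finset.prod_filter]
  refine Finset.prod_congr rfl fun i _ => ?_
  split_ifs <;> simp [ZMod.card]

theorem card_rowFactors {n p : ℕ} [NeZero p] (b : Fin n) :
    (rowFactors n p b).card = p ^ (n - 1 - b.val) := by
  have h : rowFactors n p b = Fintype.piFinset fun i =>
      if b < i then (Finset.univ : Finset (ZMod p)) else {if i = b then 1 else 0} := by
    ext v
    simp only [rowFactors, Finset.mem_filter, Finset.mem_univ, true_and, Fintype.mem_piFinset]
    constructor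
    · rintro ⟨h1, h2⟩ i
      rcases lt_trichotomy i b with h | rfl | h
      · simp [h.not_gt, h.ne, h1 i h]
      · simp [h2]
      · simp [h]
    · intro h
      refine ⟨fun j hj => ?_, ?_⟩
      · simpa [hj.not_gt, hj.ne] using h j
      · simpa using h b
  rw [h, card_piFinset_ite]
  congr 1
  rw [Finset.filter_lt_eq_Ioi, Fin.card_Ioi]

theorem card_columnFactors {n p : ℕ} [NeZero p] (b : Fin n) (hb : b.val ≠ 0) :
    (columnFactors n p b).card + p = p ^ b.val := by
  have hA : (Finset.univ.filter fun u : Fin n → ZMod p => ∀ i, b ≤ i → u i = 0) =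
      Fintype.piFinset fun i => if i < b then (Finset.univ : Finset (ZMod p)) else {0} := by
    ext u
    simp only [Finset.mem_filter, Finset.mem_univ, true_and, Fintype.mem_piFinset]
    refine forall_congr' fun i => ?_
    by_cases h : i < b
    · simp [h]
    · simp [h, not_lt.mp h]
  have hB : (Finset.univ.filter fun u : Fin n → ZMod p =>
      (∀ i, b ≤ i → u i = 0) ∧ ¬ ∃ i, i.val ≠ 0 ∧ u i ≠ 0) =
      Fintype.piFinset fun i => if i = ⟨0, b.pos⟩ then (Finset.univ : Finset (ZMod p)) else {0} := by
    ext u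
    simp only [Finset.mem_filter, Finset.mem_univ, true_and, Fintype.mem_piFinset, not_exists,
      not_and, not_not]
    constructor
    · rintro ⟨-, h⟩ i
      by_cases hi : i = ⟨0, b.pos⟩
      · simp [hi]
      · simpa [hi] using h i fun h => hi (Fin.ext h)
    · intro h
      have h' : ∀ i : Fin n, i.val ≠ 0 → u i = 0 := fun i hi => by
        simpa [Fin.ext_iff, hi] using h i
      refine ⟨fun i hi => h' i ?_, h'⟩
      rw [Fin.le_def] at hi
      omega
  have hsplit := Finset.card_filter_add_card_filter_not
    (s := Finset.univ.filter fun u : Fin n → ZMod p => ∀ i, b ≤ i → u i = 0)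
    (fun u => ∃ i, i.val ≠ 0 ∧ u i ≠ 0)
  rw [Finset.filter_filter, Finset.filter_filter, hB, hA, card_piFinset_ite, card_piFinset_ite,
    Finset.filter_gt_eq_Iio, Fin.card_Iio, Finset.filter_eq', if_pos (Finset.mem_univ _),
    Finset.card_singleton, pow_one] at hsplit
  exact hsplit

theorem columnFactors_eq_empty {n p : ℕ} [NeZero p] (b : Fin n) (hb : b.val = 0) :
    columnFactors n p b = ∅ := by
  rw [columnFactors, Finset.filter_eq_empty_iff]
  rintro u - ⟨h, i, -, hi⟩
  exact hi (h i (by rw [Fin.le_def]; omega))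

/-- The pivot column, the column factor and the row factor of the strictly upper triangular parts. -/
def factorData (n p : ℕ) [NeZero p] : Finset (Σ _ : Fin n, (Fin n → ZMod p) × (Fin n → ZMod p)) :=
  (Finset.univ.filter fun b : Fin n => b.val ≠ n - 1).sigma fun b =>
    columnFactors n p b ×ˢ rowFactors n p b

theorem sum_pow_sub_mul_pow (m : ℕ) (q : ℚ) (hq : q ≠ 1) :
    ∑ b ∈ Finset.range m, (q ^ (b + 1) - q) * q ^ (m - b) =
      q ^ 2 * ((m - 1) * q ^ m - m * q ^ (m - 1) + 1) / (q - 1) := by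
  have hq' : q - 1 ≠ 0 := sub_ne_zero.mpr hq
  have h1 : ∀ b ∈ Finset.range m, (q ^ (b + 1) - q) * q ^ (m - b) =
      q ^ (m + 1) - q ^ 2 * q ^ (m - 1 - b) := by
    intro b hb
    obtain ⟨c, rfl⟩ : ∃ c, m = b + 1 + c := ⟨m - b - 1, by have := Finset.mem_range.mp hb; omega⟩
    rw [show b + 1 + c - b = c + 1 by omega, show b + 1 + c - 1 - b = c by omega]
    ring
  rw [Finset.sum_congr rfl h1, Finset.sum_sub_distrib, ← Finset.mul_sum,
    Finset.sum_range_reflect (fun k => q ^ k), geom_sum_eq hq, eq_div_iff hq']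
  rcases m with _ | m
  · simp
  · field_simp
    simp
    ring

theorem card_factorData {n p : ℕ} (hn : 4 ≤ n) [Fact p.Prime] :
    ((factorData n p).card : ℚ) = (p : ℚ) ^ 2 * (((n : ℚ) - 3) * (p : ℚ) ^ (n - 2) -
      ((n : ℚ) - 2) * (p : ℚ) ^ (n - 3) + 1) / ((p : ℚ) - 1) := by
  have hp : p.Prime := Fact.out
  obtain ⟨m, rfl⟩ : ∃ m, n = m + 2 := ⟨n - 2, by omega⟩
  have h1 : ((factorData (m + 2) p).card : ℚ) = ∑ b : Fin (m + 2),
      if b.val ≠ 0 ∧ b.val ≠ m + 1 then ((p : ℚ) ^ b.val - p) * (p : ℚ) ^ (m + 1 - b.val) else 0 := by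
    rw [factorData, Finset.card_sigma, Finset.sum_filter, Nat.cast_sum]
    refine Finset.sum_congr rfl fun b _ => ?_
    rw [Finset.card_product, card_rowFactors]
    by_cases hb : b.val = 0
    · simp [columnFactors_eq_empty b hb, hb]
    · have h2 : ((columnFactors (m + 2) p b).card : ℚ) = (p : ℚ) ^ b.val - p := by
        rw [eq_sub_iff_add_eq]
        exact_mod_cast card_columnFactors b hb
      by_cases hb' : b.val = m + 1
      · simp [hb']
      · simp [hb, hb', h2]
  rw [h1, Fin.sum_univ_eq_sum_range (fun b => if b ≠ 0 ∧ b ≠ m + 1 then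
    ((p : ℚ) ^ b - p) * (p : ℚ) ^ (m + 1 - b) else 0), Finset.sum_range_succ,
    Finset.sum_range_succ']
  have h3 : ∀ b ∈ Finset.range m, (if b + 1 ≠ 0 ∧ b + 1 ≠ m + 1 then
      ((p : ℚ) ^ (b + 1) - p) * (p : ℚ) ^ (m + 1 - (b + 1)) else 0) =
      ((p : ℚ) ^ (b + 1) - p) * (p : ℚ) ^ (m - b) := by
    intro b hb
    have := Finset.mem_range.mp hb
    rw [if_pos (by omega), Nat.add_sub_add_right]
  rw [Finset.sum_congr rfl h3, sum_pow_sub_mul_pow m p (by exact_mod_cast hp.one_lt.ne')]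
  simp only [Nat.add_sub_cancel, show m + 2 - 3 = m - 1 by omega]
  push_cast
  simp
  ring

/-- The matrix with diagonal entries `p` whose other entries are the reduced representatives of the
entries of the product of a column and a row. -/
def rankOneLift (n p : ℕ) (x : Σ _ : Fin n, (Fin n → ZMod p) × (Fin n → ZMod p)) :
    Matrix (Fin n) (Fin n) ℤ :=
  of fun i j => if i = j then (p : ℤ) else ((x.2.1 i * x.2.2 j).val : ℤ)

theorem map_rankOneLift {n p : ℕ} [NeZero p] {b : Fin n} {u v : Fin n → ZMod p}
    (h : ⟨b, u, v⟩ ∈ factorData n p) :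
    (rankOneLift n p ⟨b, u, v⟩).map (Int.cast : ℤ → ZMod p) = vecMulVec u v := by
  simp only [factorData, columnFactors, rowFactors, Finset.mem_sigma, Finset.mem_product,
    Finset.mem_filter, Finset.mem_univ, true_and] at h
  obtain ⟨-, ⟨hu, -⟩, hv, -⟩ := h
  ext i j
  rw [map_apply, rankOneLift, of_apply, vecMulVec_apply]
  split_ifs with hij
  · subst hij
    rcases lt_or_ge i b with h | h
    · simp [hv i h]
    · simp [hu i h]
  · simp

theorem rankOneLift_injOn {n p : ℕ} [Fact p.Prime] :
    Set.InjOn (rankOneLift n p) (factorData n p) := by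
  have hle : ∀ {b u v b' u' v'}, ⟨b, u, v⟩ ∈ factorData n p → ⟨b', u', v'⟩ ∈ factorData n p →
      vecMulVec u v = vecMulVec u' v' → b' ≤ b := by
    intro b u v b' u' v' h h' he
    simp only [factorData, columnFactors, rowFactors, Finset.mem_sigma, Finset.mem_product,
      Finset.mem_filter, Finset.mem_univ, true_and] at h h'
    obtain ⟨-, ⟨-, i, -, hi⟩, -, hvb⟩ := h
    by_contra hlt
    have := congrFun (congrFun he i) b
    rw [vecMulVec_apply, vecMulVec_apply, hvb, h'.2.2.1 b (not_le.mp hlt)] at this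
    simp [hi] at this
  rintro ⟨b, u, v⟩ h ⟨b', u', v'⟩ h' he
  rw [Finset.mem_coe] at h h'
  have hvec : vecMulVec u v = vecMulVec u' v' := by
    rw [← map_rankOneLift h, ← map_rankOneLift h', he]
  obtain rfl : b = b' := le_antisymm (hle h' h hvec.symm) (hle h h' hvec)
  simp only [factorData, columnFactors, rowFactors, Finset.mem_sigma, Finset.mem_product,
    Finset.mem_filter, Finset.mem_univ, true_and] at h h'
  have hu : u = u' := by
    ext i
    have := congrFun (congrFun hvec i) b
    simpa [vecMulVec_apply, h.2.2.2, h'.2.2.2] using this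
  subst hu
  obtain ⟨i, -, hi⟩ := h.2.1.2
  have hv : v = v' := by
    ext j
    exact mul_left_cancel₀ hi (congrFun (congrFun hvec i) j)
  rw [hv]

theorem rankOneLift_mem {n p : ℕ} (hn : 4 ≤ n) [Fact p.Prime] {b : Fin n} {u v : Fin n → ZMod p}
    (h : ⟨b, u, v⟩ ∈ factorData n p) :
    rankOneLift n p ⟨b, u, v⟩ ∈ R0 n p ∧ ∃ U V : Matrix (Fin n) (Fin n) ℤ,
      IsUnit U.det ∧ IsUnit V.det ∧ scaledProduct n p (rankOneLift n p ⟨b, u, v⟩) =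
        U * diagonal (fun i => (p : ℤ) ^ outerExponent n i) * V := by
  have hp : p.Prime := Fact.out
  have hmap := map_rankOneLift h
  simp only [factorData, columnFactors, rowFactors, Finset.mem_sigma, Finset.mem_product,
    Finset.mem_filter, Finset.mem_univ, true_and] at h
  obtain ⟨hbn, ⟨hu, a, ha0, ha⟩, hv, hvb⟩ := h
  have hab : a < b := lt_of_not_ge fun h => ha (hu a h)
  have hU : ∀ i j, j < i → rankOneLift n p ⟨b, u, v⟩ i j = 0 := by
    intro i j hji
    simp only [rankOneLift, of_apply, if_neg hji.ne']
    rcases lt_or_ge i b with h | h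
    · simp [hv j (hji.trans h)]
    · simp [hu i h]
  have hD : ∀ i, rankOneLift n p ⟨b, u, v⟩ i i = p := fun i => by simp [rankOneLift]
  have hC : ((rankOneLift n p ⟨b, u, v⟩ a b : ℤ) : ZMod p) ≠ 0 := by
    have := congrFun (congrFun hmap a) b
    rw [map_apply, vecMulVec_apply, hvb, mul_one] at this
    rwa [this]
  refine ⟨mem_R0_of_vecMulVec hp _ hU hD ?_ u v hmap (a := a) (b := b) ?_ ?_, ?_⟩
  · intro i j hij
    simp only [rankOneLift, of_apply, if_neg hij.ne]
    exact ⟨by positivity, by exact_mod_cast ZMod.val_lt _⟩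
  · rwa [← ZMod.intCast_zmod_eq_zero_iff_dvd]
  · intro i j hij hjb
    simp [rankOneLift, hij.ne, hv j hjb]
  · obtain ⟨B, hB⟩ := exists_scaledProduct_mul_eq hn hp.ne_zero _ hU hD u v hmap
    refine exists_eq_mul_outerExponent_mul hn _ B (det_scaledProduct hn hp.ne_zero _ hU hD) hB
      (rank_scaledProduct hn _ u v hmap ha0 ?_ hbn hC)
    rw [Fin.lt_def] at hab
    omega

theorem exists_rankOneLift_eq {n p : ℕ} [Fact p.Prime]
    (C : Matrix (Fin n) (Fin n) ℤ) (hU : ∀ i j, j < i → C i j = 0) (hD : ∀ i, C i i = p)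
    (hR : ∀ i j : Fin n, i < j → 0 ≤ C i j ∧ C i j < (p : ℤ))
    (u v : Fin n → ZMod p) (huv : C.map (Int.cast : ℤ → ZMod p) = vecMulVec u v)
    {i j : Fin n} (hi : i.val ≠ 0) (hj : j.val ≠ n - 1) (hij : (C i j : ZMod p) ≠ 0) :
    ∃ x ∈ factorData n p, rankOneLift n p x = C := by
  have hp : p.Prime := Fact.out
  have hC : ∀ i j, (C i j : ZMod p) = u i * v j := fun i j => congrFun (congrFun huv i) j
  rw [hC] at hij
  have hne : (Finset.univ.filter fun k => v k ≠ 0).Nonempty :=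
    ⟨j, by simpa using right_ne_zero_of_mul hij⟩
  obtain ⟨b, hbv, hmin⟩ : ∃ b, v b ≠ 0 ∧ ∀ k, v k ≠ 0 → b ≤ k := by
    refine ⟨_, (Finset.mem_filter.mp (Finset.min'_mem _ hne)).2, fun k hk => ?_⟩
    exact Finset.min'_le _ _ (by simpa using hk)
  have hbj : b ≤ j := hmin j (right_ne_zero_of_mul hij)
  refine ⟨⟨b, fun k => u k * v b, fun k => v k / v b⟩, ?_, ?_⟩
  · simp only [factorData, columnFactors, rowFactors, Finset.mem_sigma, Finset.mem_product,
      Finset.mem_filter, Finset.mem_univ, true_and]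
    refine ⟨?_, ⟨fun k hk => ?_, i, hi, mul_ne_zero (left_ne_zero_of_mul hij) hbv⟩,
      fun k hk => ?_, div_self hbv⟩
    · rw [Fin.le_def] at hbj
      omega
    · rw [← hC]
      rcases hk.eq_or_lt with rfl | hk
      · simp [hD]
      · simp [hU k b hk]
    · rw [div_eq_zero_iff]
      left
      by_contra h
      exact absurd (hmin k h) (not_le.mpr hk)
  · ext k l
    simp only [rankOneLift, of_apply]
    split_ifs with hkl
    · rw [← hkl, hD]
    · have h1 : u k * v b * (v l / v b) = (C k l : ZMod p) := by
        rw [hC]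
        field_simp
      rw [h1, ZMod.val_intCast]
      rcases lt_or_gt_of_ne hkl with h | h
      · exact Int.emod_eq_of_lt (hR k l h).1 (hR k l h).2
      · rw [hU k l h, Int.zero_emod]

theorem statement11 (n p : ℕ) (hn : 4 ≤ n) (hp : p.Prime) :
    (({C₀ ∈ R0 n p | toQ n (C₀ * Dmat n p) ∈ doubleCoset n (Matrix.diagonal fun i : Fin n =>
      if i.val ≤ 1 then (p : ℚ) else if n - 2 ≤ i.val then (p : ℚ) ^ 3 else (p : ℚ) ^ 2)}.ncard : ℚ) =
      (p : ℚ) ^ 2 * (((n : ℚ) - 3) * (p : ℚ) ^ (n - 2) - ((n : ℚ) - 2) * (p : ℚ) ^ (n - 3) + 1)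
        / ((p : ℚ) - 1)) := by
  have := Fact.mk hp
  rw [← card_factorData hn, ← Set.ncard_coe_finset, ← rankOneLift_injOn.ncard_image]
  congr 2
  ext C
  constructor
  · rintro ⟨hC, hcoset⟩
    obtain ⟨hU, hdiv, -, hD, hR⟩ := hC
    obtain ⟨U, V, hU', hV', h⟩ := (mem_doubleCoset_iff hn hp.ne_zero C hU hD).mp hcoset
    obtain ⟨i, j, hi, hj, hij⟩ := exists_ne_zero_of_mem_doubleCoset hn C U V hU' hV' h
    obtain ⟨u, v, huv⟩ := exists_vecMulVec_of_detDiv_two hp C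
      (by simpa using hdiv 2 (by omega) (by omega))
    exact exists_rankOneLift_eq C hU hD hR u v huv hi hj hij
  · rintro ⟨⟨b, u, v⟩, hx, rfl⟩
    obtain ⟨hmem, h⟩ := rankOneLift_mem hn hx
    exact ⟨hmem, (mem_doubleCoset_iff hn hp.ne_zero _ hmem.1 hmem.2.2.2.1).mpr h⟩
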